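/- arXiv:1904.11646 — 2 statements merged into one kernel-verified Lean document; each statement's English description precedes it below -/
import Mathlib

section
/- If unital subalgebras A₁,…,Aₙ of A (each containing B) are infinitesimally free with respect to (E, E'), then the corresponding upper triangular subalgebras Ã₁,…,Ãₙ are free with respect to Ẽ over B̃. -/
/-- The upper triangular conditional expectation `Ẽ` read off from matrix entries. -/
def Et {A : Type*} [Ring A] [Algebra ℂ A] (E E' : A →ₗ[ℂ] A)
    (M : Matrix (Fin 2) (Fin 2) A) : Matrix (Fin 2) (Fin 2) A :=
  !![E (M 0 0), E (M 0 1) + E' (M 0 0); 0, E (M 0 0)]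

/-- Infinitesimal freeness of the subalgebras `𝒜 i` with respect to `(E, E')`. -/
def InfinitesimallyFree {A : Type*} [Ring A] [Algebra ℂ A] (E E' : A →ₗ[ℂ] A)
    {n : ℕ} (𝒜 : Fin n → Subalgebra ℂ A) : Prop :=
  ∀ (m : ℕ) (i : Fin (m + 1) → Fin n),
    (∀ j : Fin m, i j.castSucc ≠ i j.succ) →
    ∀ a : Fin (m + 1) → A, (∀ j, a j ∈ 𝒜 (i j)) → (∀ j, E (a j) = 0) →
      E (List.ofFn a).prod = 0 ∧
      E' (List.ofFn a).prod =
        ∑ j : Fin (m + 1),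
          E (((List.ofFn a).take j).prod * E' (a j) * ((List.ofFn a).drop (j + 1)).prod)

/-- Freeness of the upper triangular subalgebras `Ãᵢ` with respect to `Ẽ` over `B̃`. -/
def TildeFree {A : Type*} [Ring A] [Algebra ℂ A] (E E' : A →ₗ[ℂ] A)
    {n : ℕ} (𝒜 : Fin n → Subalgebra ℂ A) : Prop :=
  ∀ (m : ℕ) (i : Fin (m + 1) → Fin n),
    (∀ j : Fin m, i j.castSucc ≠ i j.succ) →
    ∀ a a' : Fin (m + 1) → A,
      (∀ j, a j ∈ 𝒜 (i j)) → (∀ j, a' j ∈ 𝒜 (i j)) →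
      (∀ j, Et E E' (!![a j, a' j; 0, a j]) = 0) →
      Et E E'
        (List.ofFn fun j => (!![a j, a' j; 0, a j] : Matrix (Fin 2) (Fin 2) A)).prod = 0

theorem tilde_prod {A : Type*} [Ring A] (m : ℕ) (a a' : Fin m → A) :
    (List.ofFn fun j => (!![a j, a' j; 0, a j] : Matrix (Fin 2) (Fin 2) A)).prod =
      !![(List.ofFn a).prod,
        ∑ j : Fin m, ((List.ofFn a).take j).prod * a' j * ((List.ofFn a).drop (j + 1)).prod;
        0, (List.ofFn a).prod] := by
  induction m with
  | zero => simp [Matrix.one_fin_two]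
  | succ m ih =>
    rw [List.ofFn_succ, List.prod_cons, ih (fun j => a j.succ) (fun j => a' j.succ),
      Fin.sum_univ_succ, List.ofFn_succ, Matrix.mul_fin_two]
    simp [Finset.mul_sum, mul_assoc]
    rw [add_comm]

theorem ofFn_update_prod {A : Type*} [Ring A] (m : ℕ) (a : Fin m → A) (j : Fin m) (c : A) :
    (List.ofFn (Function.update a j c)).prod =
      ((List.ofFn a).take j).prod * c * ((List.ofFn a).drop (j + 1)).prod := by
  have h : List.ofFn (Function.update a j c) = (List.ofFn a).set j c := by
    apply List.ext_getElem
    · simp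
    · intro k h1 h2
      simp only [List.getElem_ofFn, List.getElem_set, Function.update_apply, Fin.ext_iff, eq_comm]
  rw [h, List.prod_set]
  simp

/-- If the subalgebras are infinitesimally free w.r.t. (E,E') then the upper triangular subalgebras are free w.r.t. Ẽ over B̃. -/
theorem inf_free_implies_tilde_free {A : Type*} [Ring A] [Algebra ℂ A]
    (B : Subalgebra ℂ A) (E E' : A →ₗ[ℂ] A)
    (hE_mem : ∀ a, E a ∈ B) (hE'_mem : ∀ a, E' a ∈ B)
    (hE_id : ∀ b ∈ B, E b = b)
    (hE_bimod : ∀ b₁ ∈ B, ∀ b₂ ∈ B, ∀ a, E (b₁ * a * b₂) = b₁ * E a * b₂)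
    (hE'_one : E' 1 = 0)
    (hE'_bimod : ∀ b₁ ∈ B, ∀ b₂ ∈ B, ∀ a, E' (b₁ * a * b₂) = b₁ * E' a * b₂)
    {n : ℕ} (𝒜 : Fin n → Subalgebra ℂ A) (h𝒜 : ∀ i, B ≤ 𝒜 i) :
    InfinitesimallyFree E E' 𝒜 → TildeFree E E' 𝒜 := by
  intro hf m i hi a a' ha ha' h0
  have hEa : ∀ j, E (a j) = 0 := fun j => by
    simpa [Et] using congrFun (congrFun (h0 j) 0) 0
  have hEa' : ∀ j, E (a' j) + E' (a j) = 0 := fun j => by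
    simpa [Et] using congrFun (congrFun (h0 j) 0) 1
  obtain ⟨h1, h2⟩ := hf m i hi a ha hEa
  have key : ∀ j : Fin (m + 1), E (((List.ofFn a).take j).prod * (a' j + E' (a j)) *
      ((List.ofFn a).drop (j + 1)).prod) = 0 := by
    intro j
    rw [← ofFn_update_prod]
    refine (hf m i hi _ ?_ ?_).1
    · intro k
      by_cases hk : k = j
      · subst hk
        simpa using add_mem (ha' k) (h𝒜 _ (hE'_mem _))
      · simpa [hk] using ha k
    · intro k
      by_cases hk : k = j
      · subst hk
        simpa [hE_id _ (hE'_mem _)] using hEa' k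
      · simpa [hk] using hEa k
  have h3 : E (∑ j : Fin (m + 1), ((List.ofFn a).take j).prod * a' j *
      ((List.ofFn a).drop (j + 1)).prod) + E' (List.ofFn a).prod = 0 := by
    rw [h2, map_sum, ← Finset.sum_add_distrib]
    refine Finset.sum_eq_zero fun j _ => ?_
    rw [← key j, ← map_add]
    congr 1
    noncomm_ring
  rw [tilde_prod]
  ext p q
  fin_cases p <;> fin_cases q
  · simpa [Et] using h1
  · simpa [Et] using h3
  · simp [Et]
  · simpa [Et] using h1
end

section
/- The condition φ'(a₁⋯aₙ) = Σ_{k=1}^n φ(a₁⋯a_{k-1} φ'(a_k) a_{k+1}⋯aₙ) for centered alternating words, combined with freeness with respect to φ, implies: φ'(a₁⋯aₙ) = φ(a₁aₙ)φ(a₂a_{n-1})⋯φ(a_{(n-1)/2}a_{(n+3)/2})·φ'(a_{(n+1)/2}) when n is odd and i₁=iₙ, i₂=i_{n-1}, …, i_{(n-1)/2}=i_{(n+3)/2}, and φ'(a₁⋯aₙ) = 0 otherwise. -/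
/-- Value of `φ` on a product of a reversed word and a word. -/
noncomputable def pairVal {A : Type*} [Ring A] [Algebra ℂ A] {k : ℕ} (φ : A →ₗ[ℂ] ℂ) :
    List (Fin k × A) → List (Fin k × A) → ℂ
  | [], [] => 1
  | x :: L, y :: R => if x.1 = y.1 then φ (x.2 * y.2) * pairVal φ L R else 0
  | [], _ :: _ => 0
  | _ :: _, [] => 0

/-- Centered alternating words. -/
def GoodWord {A : Type*} [Ring A] [Algebra ℂ A] {k : ℕ} (φ : A →ₗ[ℂ] ℂ)
    (𝒜 : Fin k → Subalgebra ℂ A) (w : List (Fin k × A)) : Prop :=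
  List.IsChain (fun p q => p.1 ≠ q.1) w ∧ ∀ p ∈ w, p.2 ∈ 𝒜 p.1 ∧ φ p.2 = 0

theorem pairVal_zero {A : Type*} [Ring A] [Algebra ℂ A] {k : ℕ} (φ : A →ₗ[ℂ] ℂ)
    (L R : List (Fin k × A)) (h : L.map Prod.fst ≠ R.map Prod.fst) : pairVal φ L R = 0 := by
  induction L generalizing R with
  | nil => cases R <;> simp_all [pairVal]
  | cons x L ih =>
    cases R with
    | nil => simp [pairVal]
    | cons y R =>
      simp only [pairVal]
      split_ifs with hxy
      · rw [ih R (by intro h'; apply h; simp [hxy, h']), mul_zero]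
      · rfl

theorem pairVal_ofFn {A : Type*} [Ring A] [Algebra ℂ A] {k : ℕ} (φ : A →ₗ[ℂ] ℂ) (n : ℕ)
    (u v : Fin n → Fin k × A) (h : ∀ j, (u j).1 = (v j).1) :
    pairVal φ (List.ofFn u) (List.ofFn v) = ∏ j, φ ((u j).2 * (v j).2) := by
  induction n with
  | zero => simp [pairVal]
  | succ n ih =>
    rw [List.ofFn_succ, List.ofFn_succ, Fin.prod_univ_succ]
    simp only [pairVal]
    rw [if_pos (h 0), ih _ _ (fun j => h j.succ)]

theorem phi_pairVal {A : Type*} [Ring A] [Algebra ℂ A] {k : ℕ} (φ : A →ₗ[ℂ] ℂ) (hφ1 : φ 1 = 1)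
    (𝒜 : Fin k → Subalgebra ℂ A)
    (hw : ∀ w, w ≠ [] → GoodWord φ 𝒜 w → φ (w.map Prod.snd).prod = 0)
    (L R : List (Fin k × A)) (hL : GoodWord φ 𝒜 L.reverse) (hR : GoodWord φ 𝒜 R) :
    φ ((L.reverse.map Prod.snd).prod * (R.map Prod.snd).prod) = pairVal φ L R := by
  induction L generalizing R with
  | nil =>
    cases R with
    | nil => simp [pairVal, hφ1]
    | cons y R => simpa [pairVal] using hw _ (by simp) hR
  | cons x L ih =>
    cases R with
    | nil => simpa [pairVal] using hw _ (by simp) hL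
    | cons y R =>
      obtain ⟨hLc, hLm⟩ := hL
      obtain ⟨hRc, hRm⟩ := hR
      simp only [pairVal]
      have hLc' := hLc
      rw [List.reverse_cons, List.isChain_append] at hLc'
      have hRc' := hRc
      rw [List.isChain_cons] at hRc'
      split_ifs with hxy
      · have hx := hLm x (by simp)
        have hy := hRm y (by simp)
        have ih' := ih R ⟨hLc'.1, fun p hp => hLm p (by simp at hp ⊢; tauto)⟩
          ⟨hRc'.2, fun p hp => hRm p (by simp [hp])⟩
        have h0 := hw (L.reverse ++ (x.1, x.2 * y.2 - algebraMap ℂ A (φ (x.2 * y.2))) :: R)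
          (by simp) ⟨by
            rw [List.isChain_append]
            refine ⟨hLc'.1, ?_, ?_⟩
            · rw [List.isChain_cons]
              refine ⟨?_, hRc'.2⟩
              intro z hz
              simpa [hxy] using hRc'.1 z hz
            · intro z hz t ht
              have := hLc'.2.2 z hz x (by simp)
              simp at ht
              subst ht
              exact this, by
            intro p hp
            rw [List.mem_append, List.mem_cons] at hp
            rcases hp with hp | rfl | hp
            · exact hLm p (by simp at hp ⊢; tauto)
            · refine ⟨(𝒜 x.1).sub_mem ((𝒜 x.1).mul_mem hx.1 (hxy ▸ hy.1))
                ((𝒜 x.1).algebraMap_mem _), ?_⟩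
              simp [Algebra.algebraMap_eq_smul_one, hφ1]
            · exact hRm p (by simp [hp])⟩
        rw [← ih', ← sub_eq_zero, ← h0, ← smul_eq_mul (φ (x.2 * y.2)), ← map_smul, ← map_sub]
        congr 1
        simp [Algebra.algebraMap_eq_smul_one, sub_mul, mul_sub, mul_assoc]
      · have := hw ((x :: L).reverse ++ y :: R) (by simp) ⟨by
            rw [List.isChain_append]
            refine ⟨hLc, hRc, ?_⟩
            intro z hz t ht
            simp at hz ht
            subst hz ht
            exact hxy, by
            intro p hp
            rw [List.mem_append] at hp
            rcases hp with hp | hp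
            · exact hLm p hp
            · exact hRm p hp⟩
        simpa [mul_assoc] using this

/-- For infinitesimally free subalgebras and a centered alternating word `a₁⋯aₙ`:
if `n` is odd and the index pattern is symmetric (`i_j = i_{n+1-j}`) then
`φ'(a₁⋯aₙ) = φ(a₁aₙ)φ(a₂a_{n-1})⋯φ(a_{(n-1)/2}a_{(n+3)/2})·φ'(a_{(n+1)/2})`, and
otherwise `φ'(a₁⋯aₙ) = 0`. -/
theorem infinitesimal_alternating_formula {A : Type*} [Ring A] [Algebra ℂ A]
    (φ φ' : A →ₗ[ℂ] ℂ) (hφ1 : φ 1 = 1) (hφ'1 : φ' 1 = 0)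
    {k : ℕ} (𝒜 : Fin k → Subalgebra ℂ A)
    (hfree : ∀ (m : ℕ) (i : Fin (m + 1) → Fin k),
      (∀ j : Fin m, i j.castSucc ≠ i j.succ) →
      ∀ a : Fin (m + 1) → A, (∀ j, a j ∈ 𝒜 (i j)) → (∀ j, φ (a j) = 0) →
        φ (List.ofFn a).prod = 0 ∧
        φ' (List.ofFn a).prod =
          ∑ j : Fin (m + 1),
            φ' (a j) * φ (((List.ofFn a).take j).prod * ((List.ofFn a).drop (j + 1)).prod))
    (m : ℕ) (i : Fin (m + 1) → Fin k)
    (halt : ∀ j : Fin m, i j.castSucc ≠ i j.succ)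
    (a : Fin (m + 1) → A) (hmem : ∀ j, a j ∈ 𝒜 (i j)) (hcent : ∀ j, φ (a j) = 0) :
    (∀ p : ℕ, ∀ hp : m = 2 * p, (∀ j : Fin (m + 1), i j = i j.rev) →
      φ' (List.ofFn a).prod =
        (∏ j : Fin p,
            φ (a ⟨j.1, by omega⟩ * a ⟨m - j.1, by omega⟩)) *
          φ' (a ⟨p, by omega⟩)) ∧
    (((∀ p : ℕ, m ≠ 2 * p) ∨ ¬(∀ j : Fin (m + 1), i j = i j.rev)) →
      φ' (List.ofFn a).prod = 0) := by
  have hw : ∀ w, w ≠ [] → GoodWord φ 𝒜 w → φ (w.map Prod.snd).prod = 0 := by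
    intro w hne ⟨hc, hm⟩
    obtain ⟨n, hn⟩ : ∃ n, w.length = n + 1 :=
      Nat.exists_eq_succ_of_ne_zero (by simpa using hne)
    have := (hfree n (fun j => (w[j.1]'(by omega)).1)
      (fun j => by
        rw [List.isChain_iff_getElem] at hc
        exact hc j.1 (by have := j.2; omega))
      (fun j => (w[j.1]'(by omega)).2)
      (fun j => (hm _ (List.getElem_mem _)).1) (fun j => (hm _ (List.getElem_mem _)).2)).1
    rw [← this]
    congr 2
    apply List.ext_getElem
    · simp [hn]
    · intro t h1 h2
      rw [List.getElem_map, List.getElem_ofFn]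
  set w : List (Fin k × A) := List.ofFn (fun j => (i j, a j)) with hwdef
  have hwa : List.ofFn a = w.map Prod.snd := by
    rw [hwdef, List.map_ofFn]; rfl
  have hlen : w.length = m + 1 := by simp [hwdef]
  have hget : ∀ t (h : t < w.length), w[t] = (i ⟨t, by omega⟩, a ⟨t, by omega⟩) := by
    intro t h
    simp only [hwdef, List.getElem_ofFn]
  have hgood : GoodWord φ 𝒜 w := by
    constructor
    · rw [List.isChain_iff_getElem]
      intro t ht
      rw [hget, hget]
      exact halt ⟨t, by omega⟩
    · intro p hp
      rw [hwdef, List.mem_ofFn] at hp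
      obtain ⟨j, rfl⟩ := hp
      exact ⟨hmem j, hcent j⟩
  have hterm : ∀ j : ℕ, φ (((List.ofFn a).take j).prod * ((List.ofFn a).drop (j + 1)).prod)
      = pairVal φ (w.take j).reverse (w.drop (j + 1)) := by
    intro j
    rw [← phi_pairVal φ hφ1 𝒜 hw, hwa, List.reverse_reverse, List.map_take, List.map_drop]
    · rw [List.reverse_reverse]
      exact ⟨hgood.1.take _, fun p hp => hgood.2 p (List.mem_of_mem_take hp)⟩
    · exact ⟨hgood.1.drop _, fun p hp => hgood.2 p (List.mem_of_mem_drop hp)⟩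
  have hmain := (hfree m i halt a hmem hcent).2
  simp only [hterm] at hmain
  rw [hmain]
  constructor
  · intro p hp hsym
    rw [Finset.sum_eq_single (⟨p, by omega⟩ : Fin (m + 1))]
    · have hL : (w.take p).reverse = List.ofFn (fun j : Fin p =>
          (i ⟨p - 1 - j.1, by omega⟩, a ⟨p - 1 - j.1, by omega⟩)) := by
        apply List.ext_getElem
        · simp [hlen]; omega
        · intro t h1 h2
          have hmin : min p w.length = p := by omega
          simp [hget, hlen]
          have : min p (m + 1) = p := by omega
          simp [this]
      have hR : w.drop (p + 1) = List.ofFn (fun j : Fin p =>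
          (i ⟨p + 1 + j.1, by omega⟩, a ⟨p + 1 + j.1, by omega⟩)) := by
        apply List.ext_getElem
        · simp [hlen]; omega
        · intro t h1 h2
          simp [hget]
      rw [mul_comm]
      congr 1
      simp only
      rw [hL, hR, pairVal_ofFn]
      · rw [← Equiv.prod_comp Fin.revPerm]
        apply Finset.prod_congr rfl
        intro j _
        have hj := j.2
        have e1 : p - 1 - (Fin.revPerm j).1 = j.1 := by
          simp only [Fin.revPerm_apply, Fin.val_rev]; omega
        have e2 : p + 1 + (Fin.revPerm j).1 = m - j.1 := by
          simp only [Fin.revPerm_apply, Fin.val_rev]; omega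
        simp only [e1, e2]
      · intro j
        have hj := j.2
        simp only
        rw [hsym]
        congr 1
        ext
        simp [Fin.val_rev]; omega
    · intro j _ hj
      rw [pairVal_zero, mul_zero]
      intro h
      have := congrArg List.length h
      simp [hlen] at this
      apply hj
      ext
      simp only
      omega
    · simp
  · intro h
    apply Finset.sum_eq_zero
    intro j _
    rw [pairVal_zero, mul_zero]
    intro he
    have hl := congrArg List.length he
    simp [hlen] at hl
    have hj : m = 2 * j.1 := by omega
    rcases h with h | h
    · exact h _ hj
    apply h
    have key : ∀ s (hs : s < j.1), i ⟨j.1 - 1 - s, by omega⟩ = i ⟨j.1 + 1 + s, by omega⟩ := by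
      intro s hs
      have h1 : s < ((w.take j.1).reverse.map Prod.fst).length := by simp [hlen]; omega
      have h2 := List.getElem_of_eq he h1
      have : min j.1 (m + 1) = j.1 := by omega
      simpa [hget, hlen, this] using h2
    intro t
    have ht := t.2
    rcases lt_trichotomy t.1 j.1 with hlt | heq | hgt
    · convert key (j.1 - 1 - t.1) (by omega) using 2
      · ext; simp only; omega
      · ext; simp only [Fin.val_rev]; omega
    · congr 1
      ext; simp only [Fin.val_rev]; omega
    · symm
      convert key (t.1 - j.1 - 1) (by omega) using 2
      · ext; simp only [Fin.val_rev]; omega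
      · ext; simp only; omega
end
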